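/- Let n ≥ 1, let B = ([0,n]ℤ × [0,2]ℤ) \ ([1,n]ℤ × {1}) ⊂ ℤ² and let C = [0,n]ℤ × {0} ⊆ B. Then the Hausdorff metrics based on the shortest-path metrics in B satisfy H_{(B,c₁)}(B,C) = n + 2 and H_{(B,c₂)}(B,C) = n + 1. -/

import Mathlib

/-- `c₁`-adjacency on `ℤ²`: the points differ by exactly 1 in exactly one
coordinate and agree in the other. -/
def c1Adj (x y : ℤ × ℤ) : Prop :=
  (|x.1 - y.1| = 1 ∧ x.2 = y.2) ∨ (x.1 = y.1 ∧ |x.2 - y.2| = 1)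

/-- `c₂`-adjacency (8-adjacency) on `ℤ²`: distinct points differing by at
most 1 in each coordinate. -/
def c2Adj (x y : ℤ × ℤ) : Prop :=
  x ≠ y ∧ |x.1 - y.1| ≤ 1 ∧ |x.2 - y.2| ≤ 1

/-- `pathIn adj X m a b` : there is a path of length `m` in `X` from `a` to `b`
with consecutive points `adj`-adjacent. -/
def pathIn {α : Type*} (adj : α → α → Prop) (X : Set α) (m : ℕ) (a b : α) : Prop :=
  ∃ f : ℕ → α, f 0 = a ∧ f m = b ∧ (∀ i ≤ m, f i ∈ X) ∧ ∀ i < m, adj (f i) (f (i + 1))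

/-- The Hausdorff "metric" between `A, B ⊆ X` based on shortest paths in `X`:
the least `ε` such that each point of either set is joined by a path in `X` of
length at most `ε` to a point of the other set. -/
noncomputable def hausdSP {α : Type*} (adj : α → α → Prop) (X A B : Set α) : ℕ :=
  sInf {ε : ℕ | (∀ a ∈ A, ∃ b ∈ B, ∃ m ≤ ε, pathIn adj X m a b) ∧
                (∀ b ∈ B, ∃ a ∈ A, ∃ m ≤ ε, pathIn adj X m b a)}

theorem pathIn_lip {α : Type*} (adj : α → α → Prop) (X : Set α) (φ : α → ℕ)
    (lip : ∀ a ∈ X, ∀ b ∈ X, adj a b → φ a ≤ φ b + 1) (m : ℕ) (a b : α)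
    (h : pathIn adj X m a b) : φ a ≤ φ b + m := by
  obtain ⟨f, rfl, rfl, hX, hadj⟩ := h
  have key : ∀ i ≤ m, φ (f 0) ≤ φ (f i) + i := by
    intro i
    induction i with
    | zero => intro _; simp
    | succ k ih =>
      intro hk
      have h1 := ih (by omega)
      have h2 := lip _ (hX k (by omega)) _ (hX (k+1) hk) (hadj k (by omega))
      omega
  exact key m le_rfl

theorem pathIn_descend {α : Type*} (adj : α → α → Prop) (X C : Set α) (φ : α → ℕ)
    (hz : ∀ a ∈ X, φ a = 0 → a ∈ C)
    (step : ∀ a ∈ X, φ a ≠ 0 → ∃ b ∈ X, adj a b ∧ φ a = φ b + 1) (k : ℕ) :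
    ∀ a ∈ X, φ a = k → ∃ b ∈ C, pathIn adj X k a b := by
  induction k with
  | zero =>
    intro a ha h
    exact ⟨a, hz a ha h, fun _ => a, rfl, rfl, fun _ _ => ha, fun i hi => by omega⟩
  | succ k ih =>
    intro a ha h
    obtain ⟨b, hb, hab, hφ⟩ := step a ha (by omega)
    obtain ⟨c, hc, f, hf0, hfm, hfX, hfa⟩ := ih b hb (by omega)
    refine ⟨c, hc, fun i => Nat.casesOn i a f, rfl, hfm, ?_, ?_⟩
    · intro i hi
      cases i with
      | zero => exact ha
      | succ j => exact hfX j (by omega)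
    · intro i hi
      cases i with
      | zero => change adj a (f 0); rw [hf0]; exact hab
      | succ j => exact hfa j (by omega)

theorem hausd_aux {α : Type*} (adj : α → α → Prop) (X C : Set α) (φ : α → ℕ) (N : ℕ)
    (hCX : C ⊆ X) (h0 : ∀ a ∈ C, φ a = 0)
    (hz : ∀ a ∈ X, φ a = 0 → a ∈ C)
    (step : ∀ a ∈ X, φ a ≠ 0 → ∃ b ∈ X, adj a b ∧ φ a = φ b + 1)
    (lip : ∀ a ∈ X, ∀ b ∈ X, adj a b → φ a ≤ φ b + 1)
    (hN : ∀ a ∈ X, φ a ≤ N) (p : α) (hp : p ∈ X) (hpN : φ p = N) :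
    hausdSP adj X X C = N := by
  unfold hausdSP
  apply IsLeast.csInf_eq
  refine ⟨⟨?_, ?_⟩, ?_⟩
  · intro a ha
    obtain ⟨b, hb, h⟩ := pathIn_descend adj X C φ hz step _ a ha rfl
    exact ⟨b, hb, _, hN a ha, h⟩
  · intro b hb
    exact ⟨b, hCX hb, 0, by omega, fun _ => b, rfl, rfl, fun _ _ => hCX hb,
      fun i hi => by omega⟩
  · rintro ε ⟨h, -⟩
    obtain ⟨b, hb, m, hm, hpath⟩ := h p hp
    have := pathIn_lip adj X φ lip m p b hpath
    have := h0 b hb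
    omega

/-- For `B = ([0,n]ℤ × [0,2]ℤ) \ ([1,n]ℤ × {1})` and
`C = [0,n]ℤ × {0} ⊆ B`, the Hausdorff metrics based on the shortest-path
metrics in `B` satisfy `H_{(B,c₁)}(B,C) = n + 2` and `H_{(B,c₂)}(B,C) = n + 1`. -/
theorem shortestPath_hausdorff_C_and_bottom_row
    (n : ℕ) (hn : 1 ≤ n)
    (B C : Set (ℤ × ℤ))
    (hB : B = (Set.Icc (0 : ℤ) (n : ℤ) ×ˢ Set.Icc (0 : ℤ) (2 : ℤ)) \
              (Set.Icc (1 : ℤ) (n : ℤ) ×ˢ ({1} : Set ℤ)))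
    (hC : C = Set.Icc (0 : ℤ) (n : ℤ) ×ˢ ({0} : Set ℤ)) :
    hausdSP c1Adj B B C = n + 2 ∧ hausdSP c2Adj B B C = n + 1 := by
  have mB : ∀ x y : ℤ, (x, y) ∈ B ↔
      (0 ≤ x ∧ x ≤ n ∧ 0 ≤ y ∧ y ≤ 2 ∧ (y = 1 → x = 0)) := by
    intro x y
    subst hB
    simp only [Set.mem_sdiff, Set.mem_prod, Set.mem_Icc, Set.mem_singleton_iff]
    omega
  have mC : ∀ x y : ℤ, (x, y) ∈ C ↔ (0 ≤ x ∧ x ≤ n ∧ y = 0) := by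
    intro x y
    subst hC
    simp only [Set.mem_prod, Set.mem_Icc, Set.mem_singleton_iff]
    omega
  clear hB hC
  constructor
  · refine hausd_aux c1Adj B C
      (fun p => if p.2 = 0 then 0 else if p.2 = 1 then 1 else p.1.toNat + 2) (n + 2)
      ?_ ?_ ?_ ?_ ?_ ?_ ((n : ℤ), 2) ?_ ?_
    · rintro ⟨x, y⟩; rw [mB, mC]; omega
    · rintro ⟨x, y⟩; rw [mC]; dsimp only; intro h; split_ifs <;> omega
    · rintro ⟨x, y⟩; rw [mB, mC]; dsimp only; intro h h2; split_ifs at h2 <;> omega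
    · rintro ⟨x, y⟩; rw [mB]; dsimp only; intro h hne
      by_cases hx : x = 0
      · refine ⟨(x, y - 1), ?_, ?_, ?_⟩
        · rw [mB]; split_ifs at hne <;> omega
        · right; simp
        · dsimp only; split_ifs at * <;> omega
      · refine ⟨(x - 1, y), ?_, ?_, ?_⟩
        · rw [mB]; split_ifs at hne <;> omega
        · left; simp
        · dsimp only; split_ifs at * <;> omega
    · rintro ⟨x, y⟩ h ⟨z, w⟩ h' hadj
      rw [mB] at h h'
      simp only [c1Adj, abs_eq (zero_le_one : (0:ℤ) ≤ 1)] at hadj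
      dsimp only
      split_ifs <;> omega
    · rintro ⟨x, y⟩; rw [mB]; dsimp only; intro h; split_ifs <;> omega
    · rw [mB]; omega
    · simp
  · refine hausd_aux c2Adj B C
      (fun p => if p.2 = 0 then 0 else if p.2 = 1 then 1 else
        if p.1 = 0 then 2 else p.1.toNat + 1) (n + 1)
      ?_ ?_ ?_ ?_ ?_ ?_ ((n : ℤ), 2) ?_ ?_
    · rintro ⟨x, y⟩; rw [mB, mC]; omega
    · rintro ⟨x, y⟩; rw [mC]; dsimp only; intro h; split_ifs <;> omega
    · rintro ⟨x, y⟩; rw [mB, mC]; dsimp only; intro h h2; split_ifs at h2 <;> omega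
    · rintro ⟨x, y⟩; rw [mB]; dsimp only; intro h hne
      by_cases hx : x ≤ 1
      · refine ⟨(0, y - 1), ?_, ?_, ?_⟩
        · rw [mB]; split_ifs at hne <;> omega
        · simp only [c2Adj, ne_eq, Prod.mk.injEq, abs_le]; omega
        · dsimp only; split_ifs at * <;> omega
      · refine ⟨(x - 1, y), ?_, ?_, ?_⟩
        · rw [mB]; split_ifs at hne <;> omega
        · simp only [c2Adj, ne_eq, Prod.mk.injEq, abs_le]; omega
        · dsimp only; split_ifs at * <;> omega
    · rintro ⟨x, y⟩ h ⟨z, w⟩ h' hadj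
      rw [mB] at h h'
      simp only [c2Adj] at hadj
      have h1 := hadj.2.1
      have h2 := hadj.2.2
      rw [abs_le] at h1 h2
      clear hadj
      dsimp only
      split_ifs <;> omega
    · rintro ⟨x, y⟩; rw [mB]; dsimp only; intro h; split_ifs <;> omega
    · rw [mB]; omega
    · dsimp only; split_ifs <;> omega
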